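/- Let I be the two-sided ideal of B generated by the single element Y*X + X*Y (equivalently, by s − 1). Then there is a ℤ-algebra isomorphism B ⧸ I ≅ B₀ sending the residue classes of the generators E₁, E₂, X, Y of B to the generators E₁, E₂, X, Y of B₀. Equivalently (since I is the ideal generated by φ(u) − 1 with φ(u) = s central), the base change B ⊗_{ℤ[u,u⁻¹]} ℤ along the augmentation ℤ[u,u⁻¹] → ℤ, u ↦ 1, is isomorphic to B₀. (Proposition 'reduction of the Beilinson quiver algebra'.) -/

import Mathlib

open FreeAlgebra in
inductive BRel : FreeAlgebra ℤ (Fin 5) → FreeAlgebra ℤ (Fin 5) → Prop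
  | unit : BRel (ι ℤ (0 : Fin 5) + ι ℤ 1) 1
  | idem₁ : BRel (ι ℤ (0 : Fin 5) * ι ℤ 0) (ι ℤ 0)
  | idem₂ : BRel (ι ℤ (1 : Fin 5) * ι ℤ 1) (ι ℤ 1)
  | orth₁₂ : BRel (ι ℤ (0 : Fin 5) * ι ℤ 1) 0
  | orth₂₁ : BRel (ι ℤ (1 : Fin 5) * ι ℤ 0) 0
  | e₂x : BRel (ι ℤ (1 : Fin 5) * ι ℤ 2) (ι ℤ 2)
  | xe₁ : BRel (ι ℤ (2 : Fin 5) * ι ℤ 0) (ι ℤ 2)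
  | e₁y : BRel (ι ℤ (0 : Fin 5) * ι ℤ 3) (ι ℤ 3)
  | ye₂ : BRel (ι ℤ (3 : Fin 5) * ι ℤ 1) (ι ℤ 3)
  | sInvLeft : BRel (ι ℤ (4 : Fin 5) * (1 + ι ℤ 3 * ι ℤ 2 + ι ℤ 2 * ι ℤ 3)) 1
  | sInvRight : BRel ((1 + ι ℤ (3 : Fin 5) * ι ℤ 2 + ι ℤ 2 * ι ℤ 3) * ι ℤ 4) 1

abbrev B := RingQuot BRel

noncomputable def mkB : FreeAlgebra ℤ (Fin 5) →ₐ[ℤ] B := RingQuot.mkAlgHom ℤ BRel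

noncomputable def E₁ : B := mkB (FreeAlgebra.ι ℤ 0)
noncomputable def E₂ : B := mkB (FreeAlgebra.ι ℤ 1)
noncomputable def Xg : B := mkB (FreeAlgebra.ι ℤ 2)
noncomputable def Yg : B := mkB (FreeAlgebra.ι ℤ 3)
noncomputable def S' : B := mkB (FreeAlgebra.ι ℤ 4)

noncomputable def sB : B := 1 + Yg * Xg + Xg * Yg

lemma S'_mul_s : S' * sB = 1 := by
  have h := RingQuot.mkAlgHom_rel ℤ BRel.sInvLeft
  simpa [sB, S', Yg, Xg, mkB, map_mul, map_add, map_one] using h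

lemma s_mul_S' : sB * S' = 1 := by
  have h := RingQuot.mkAlgHom_rel ℤ BRel.sInvRight
  simpa [sB, S', Yg, Xg, mkB, map_mul, map_add, map_one] using h


open FreeAlgebra in
/-- The defining relations of the algebra `B₀`, on the four generators
`E₁ = ι 0`, `E₂ = ι 1`, `X = ι 2`, `Y = ι 3`. -/
inductive B0Rel : FreeAlgebra ℤ (Fin 4) → FreeAlgebra ℤ (Fin 4) → Prop
  | unit : B0Rel (ι ℤ (0 : Fin 4) + ι ℤ 1) 1
  | idem₁ : B0Rel (ι ℤ (0 : Fin 4) * ι ℤ 0) (ι ℤ 0)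
  | idem₂ : B0Rel (ι ℤ (1 : Fin 4) * ι ℤ 1) (ι ℤ 1)
  | orth₁₂ : B0Rel (ι ℤ (0 : Fin 4) * ι ℤ 1) 0
  | orth₂₁ : B0Rel (ι ℤ (1 : Fin 4) * ι ℤ 0) 0
  | e₂x : B0Rel (ι ℤ (1 : Fin 4) * ι ℤ 2) (ι ℤ 2)
  | xe₁ : B0Rel (ι ℤ (2 : Fin 4) * ι ℤ 0) (ι ℤ 2)
  | e₁y : B0Rel (ι ℤ (0 : Fin 4) * ι ℤ 3) (ι ℤ 3)
  | ye₂ : B0Rel (ι ℤ (3 : Fin 4) * ι ℤ 1) (ι ℤ 3)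
  | xy : B0Rel (ι ℤ (2 : Fin 4) * ι ℤ 3) 0
  | yx : B0Rel (ι ℤ (3 : Fin 4) * ι ℤ 2) 0

/-- The algebra `B₀`: the stalk at the origin of the cosheaf `𝓑₀`. -/
abbrev B₀ := RingQuot B0Rel

noncomputable def mkB₀ : FreeAlgebra ℤ (Fin 4) →ₐ[ℤ] B₀ := RingQuot.mkAlgHom ℤ B0Rel

noncomputable def E₁' : B₀ := mkB₀ (FreeAlgebra.ι ℤ 0)
noncomputable def E₂' : B₀ := mkB₀ (FreeAlgebra.ι ℤ 1)
noncomputable def Xg' : B₀ := mkB₀ (FreeAlgebra.ι ℤ 2)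
noncomputable def Yg' : B₀ := mkB₀ (FreeAlgebra.ι ℤ 3)

/-- The two-sided ideal of `B` generated by `Y*X + X*Y = s - 1`. -/
noncomputable def Is : TwoSidedIdeal B := TwoSidedIdeal.span {Yg * Xg + Xg * Yg}

/-- The quotient of `B` by the two-sided ideal `Is`. -/
abbrev Bred := Is.ringCon.Quotient

/-- The quotient map `B → B ⧸ Is`. -/
noncomputable def qB : B →+* Bred := Is.ringCon.mk'

lemma E₁_add_E₂ : E₁ + E₂ = 1 := by
  simpa [E₁, E₂, mkB] using RingQuot.mkAlgHom_rel ℤ BRel.unit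

lemma E₁_mul_E₁ : E₁ * E₁ = E₁ := by
  simpa [E₁, mkB] using RingQuot.mkAlgHom_rel ℤ BRel.idem₁

lemma E₂_mul_E₂ : E₂ * E₂ = E₂ := by
  simpa [E₂, mkB] using RingQuot.mkAlgHom_rel ℤ BRel.idem₂

lemma E₁_mul_E₂ : E₁ * E₂ = 0 := by
  simpa [E₁, E₂, mkB] using RingQuot.mkAlgHom_rel ℤ BRel.orth₁₂

lemma E₂_mul_E₁ : E₂ * E₁ = 0 := by
  simpa [E₁, E₂, mkB] using RingQuot.mkAlgHom_rel ℤ BRel.orth₂₁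

lemma E₂_mul_Xg : E₂ * Xg = Xg := by
  simpa [E₂, Xg, mkB] using RingQuot.mkAlgHom_rel ℤ BRel.e₂x

lemma Xg_mul_E₁ : Xg * E₁ = Xg := by
  simpa [E₁, Xg, mkB] using RingQuot.mkAlgHom_rel ℤ BRel.xe₁

lemma E₁_mul_Yg : E₁ * Yg = Yg := by
  simpa [E₁, Yg, mkB] using RingQuot.mkAlgHom_rel ℤ BRel.e₁y

lemma Yg_mul_E₂ : Yg * E₂ = Yg := by
  simpa [E₂, Yg, mkB] using RingQuot.mkAlgHom_rel ℤ BRel.ye₂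

lemma qB_Yg_mul_Xg_add_Xg_mul_Yg : qB (Yg * Xg + Xg * Yg) = 0 := by
  rw [← map_zero qB]
  exact (RingCon.eq _).2 ((TwoSidedIdeal.mem_iff _ _).1 (TwoSidedIdeal.subset_span rfl))

lemma qB_Yg_mul_Xg : qB (Yg * Xg) = 0 := by
  have h : Yg * Xg = E₁ * (Yg * Xg + Xg * Yg) := by
    rw [mul_add, ← mul_assoc, E₁_mul_Yg, ← mul_assoc E₁ Xg, ← E₂_mul_Xg, ← mul_assoc E₁ E₂,
      E₁_mul_E₂, zero_mul, zero_mul, add_zero]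
  rw [h, map_mul, qB_Yg_mul_Xg_add_Xg_mul_Yg, mul_zero]

lemma qB_Xg_mul_Yg : qB (Xg * Yg) = 0 := by
  have h := qB_Yg_mul_Xg_add_Xg_mul_Yg
  rwa [map_add, qB_Yg_mul_Xg, zero_add] at h

lemma Xg'_mul_Yg' : Xg' * Yg' = 0 := by
  simpa [Xg', Yg', mkB₀] using RingQuot.mkAlgHom_rel ℤ B0Rel.xy

lemma Yg'_mul_Xg' : Yg' * Xg' = 0 := by
  simpa [Xg', Yg', mkB₀] using RingQuot.mkAlgHom_rel ℤ B0Rel.yx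

/-- The algebra homomorphism `B → B₀` fixing `E₁, E₂, X, Y` and sending `S'` to `1`. -/
noncomputable def BToB₀ : B →ₐ[ℤ] B₀ :=
  RingQuot.liftAlgHom ℤ ⟨FreeAlgebra.lift ℤ ![E₁', E₂', Xg', Yg', 1], by
    rintro _ _ (_ | _ | _ | _ | _ | _ | _ | _ | _ | _ | _)
    · simpa [E₁', E₂', mkB₀] using RingQuot.mkAlgHom_rel ℤ B0Rel.unit
    · simpa [E₁', mkB₀] using RingQuot.mkAlgHom_rel ℤ B0Rel.idem₁
    · simpa [E₂', mkB₀] using RingQuot.mkAlgHom_rel ℤ B0Rel.idem₂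
    · simpa [E₁', E₂', mkB₀] using RingQuot.mkAlgHom_rel ℤ B0Rel.orth₁₂
    · simpa [E₁', E₂', mkB₀] using RingQuot.mkAlgHom_rel ℤ B0Rel.orth₂₁
    · simpa [E₂', Xg', mkB₀] using RingQuot.mkAlgHom_rel ℤ B0Rel.e₂x
    · simpa [E₁', Xg', mkB₀] using RingQuot.mkAlgHom_rel ℤ B0Rel.xe₁
    · simpa [E₁', Yg', mkB₀] using RingQuot.mkAlgHom_rel ℤ B0Rel.e₁y
    · simpa [E₂', Yg', mkB₀] using RingQuot.mkAlgHom_rel ℤ B0Rel.ye₂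
    · simp [Xg'_mul_Yg', Yg'_mul_Xg']
    · simp [Xg'_mul_Yg', Yg'_mul_Xg']⟩

lemma BToB₀_mkB (x : FreeAlgebra ℤ (Fin 5)) :
    BToB₀ (mkB x) = FreeAlgebra.lift ℤ ![E₁', E₂', Xg', Yg', 1] x :=
  RingQuot.liftAlgHom_mkAlgHom_apply ..

lemma BToB₀_E₁ : BToB₀ E₁ = E₁' := by simp [E₁, BToB₀_mkB]

lemma BToB₀_E₂ : BToB₀ E₂ = E₂' := by simp [E₂, BToB₀_mkB]

lemma BToB₀_Xg : BToB₀ Xg = Xg' := by simp [Xg, BToB₀_mkB]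

lemma BToB₀_Yg : BToB₀ Yg = Yg' := by simp [Yg, BToB₀_mkB]

lemma BToB₀_S' : BToB₀ S' = 1 := by simp [S', BToB₀_mkB]

lemma Is_le_ker_BToB₀ : Is ≤ TwoSidedIdeal.ker BToB₀ := by
  refine TwoSidedIdeal.span_le.2 (Set.singleton_subset_iff.2 ?_)
  simp [TwoSidedIdeal.mem_ker, BToB₀_Xg, BToB₀_Yg, Xg'_mul_Yg', Yg'_mul_Xg']

/-- The algebra homomorphism `B ⧸ Is → B₀` induced by `BToB₀`. -/
noncomputable def BredToB₀ : Bred →ₐ[ℤ] B₀ :=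
  Is.ringCon.liftₐ BToB₀ fun _ _ h =>
    (TwoSidedIdeal.ker_ringCon _).1 (TwoSidedIdeal.ringCon_le_iff.1 Is_le_ker_BToB₀ h)

/-- The algebra homomorphism `B₀ → B ⧸ Is` sending generators to residue classes of generators. -/
noncomputable def B₀ToBred : B₀ →ₐ[ℤ] Bred :=
  RingQuot.liftAlgHom ℤ ⟨FreeAlgebra.lift ℤ ![qB E₁, qB E₂, qB Xg, qB Yg], by
    rintro _ _ (_ | _ | _ | _ | _ | _ | _ | _ | _ | _ | _)
    · simpa using congrArg qB E₁_add_E₂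
    · simpa using congrArg qB E₁_mul_E₁
    · simpa using congrArg qB E₂_mul_E₂
    · simpa using congrArg qB E₁_mul_E₂
    · simpa using congrArg qB E₂_mul_E₁
    · simpa using congrArg qB E₂_mul_Xg
    · simpa using congrArg qB Xg_mul_E₁
    · simpa using congrArg qB E₁_mul_Yg
    · simpa using congrArg qB Yg_mul_E₂
    · simpa using qB_Xg_mul_Yg
    · simpa using qB_Yg_mul_Xg⟩

lemma B₀ToBred_mkB₀ (x : FreeAlgebra ℤ (Fin 4)) :
    B₀ToBred (mkB₀ x) = FreeAlgebra.lift ℤ ![qB E₁, qB E₂, qB Xg, qB Yg] x :=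
  RingQuot.liftAlgHom_mkAlgHom_apply ..

lemma B₀ToBred_E₁' : B₀ToBred E₁' = qB E₁ := by simp [E₁', B₀ToBred_mkB₀]

lemma B₀ToBred_E₂' : B₀ToBred E₂' = qB E₂ := by simp [E₂', B₀ToBred_mkB₀]

lemma B₀ToBred_Xg' : B₀ToBred Xg' = qB Xg := by simp [Xg', B₀ToBred_mkB₀]

lemma B₀ToBred_Yg' : B₀ToBred Yg' = qB Yg := by simp [Yg', B₀ToBred_mkB₀]

lemma qB_S' : qB S' = 1 := by
  have h := congrArg qB S'_mul_s
  rwa [sB, add_assoc, map_mul, map_add, qB_Yg_mul_Xg_add_Xg_mul_Yg, add_zero, map_one,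
    mul_one] at h

lemma BredToB₀_comp_B₀ToBred : BredToB₀.comp B₀ToBred = AlgHom.id ℤ B₀ := by
  refine RingQuot.ringQuot_ext' _ _ _ (FreeAlgebra.hom_ext (funext fun i => ?_))
  change BredToB₀ (B₀ToBred (mkB₀ (FreeAlgebra.ι ℤ i))) = mkB₀ (FreeAlgebra.ι ℤ i)
  fin_cases i
  · exact (congrArg BredToB₀ B₀ToBred_E₁').trans BToB₀_E₁
  · exact (congrArg BredToB₀ B₀ToBred_E₂').trans BToB₀_E₂
  · exact (congrArg BredToB₀ B₀ToBred_Xg').trans BToB₀_Xg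
  · exact (congrArg BredToB₀ B₀ToBred_Yg').trans BToB₀_Yg

lemma B₀ToBred_comp_BToB₀ : B₀ToBred.comp BToB₀ = Is.ringCon.mkₐ ℤ := by
  refine RingQuot.ringQuot_ext' _ _ _ (FreeAlgebra.hom_ext (funext fun i => ?_))
  change B₀ToBred (BToB₀ (mkB (FreeAlgebra.ι ℤ i))) = qB (mkB (FreeAlgebra.ι ℤ i))
  fin_cases i
  · exact (congrArg B₀ToBred BToB₀_E₁).trans B₀ToBred_E₁'
  · exact (congrArg B₀ToBred BToB₀_E₂).trans B₀ToBred_E₂'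
  · exact (congrArg B₀ToBred BToB₀_Xg).trans B₀ToBred_Xg'
  · exact (congrArg B₀ToBred BToB₀_Yg).trans B₀ToBred_Yg'
  · exact (congrArg B₀ToBred BToB₀_S').trans ((map_one B₀ToBred).trans qB_S'.symm)

lemma B₀ToBred_comp_BredToB₀ : B₀ToBred.comp BredToB₀ = AlgHom.id ℤ Bred := by
  refine AlgHom.ext fun x => ?_
  obtain ⟨b, rfl⟩ := Is.ringCon.mk'_surjective x
  exact AlgHom.congr_fun B₀ToBred_comp_BToB₀ b

/-- Proposition "reduction of the Beilinson quiver": the quotient of `B` by the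
two-sided ideal generated by `Y*X + X*Y` (equivalently, the base change of `B`
along `ℤ[u,u⁻¹] → ℤ`, `u ↦ 1`) is isomorphic to `B₀`, matching up the residue
classes of the generators `E₁, E₂, X, Y`. -/
theorem reduction_of_beilinson_quiver :
    ∃ e : Bred ≃ₐ[ℤ] B₀,
      e (qB E₁) = E₁' ∧ e (qB E₂) = E₂' ∧ e (qB Xg) = Xg' ∧ e (qB Yg) = Yg' := by
  exact ⟨AlgEquiv.ofAlgHom BredToB₀ B₀ToBred BredToB₀_comp_B₀ToBred B₀ToBred_comp_BredToB₀,
    BToB₀_E₁, BToB₀_E₂, BToB₀_Xg, BToB₀_Yg⟩
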